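/- Let f : (0,∞) → [0,∞) be absolutely continuous with lim_{r→0} f(r) = 0, lim_{r→∞} f(r) = 0, f not identically zero, and suppose ( ∫_0^∞ r |f'(r)|² dr ) · ( ∫_0^∞ |f(r)|²/r dr ) = ‖f‖_{L^∞}⁴. Then there exist constants A > 0, b > 0 and c > 0 such that f(r) = A (br)^{c} for r ≤ 1/b and f(r) = A (br)^{−c} for r ≥ 1/b. -/

import Mathlib

open MeasureTheory
open scoped ENNReal

noncomputable section

/-- `f` is (locally) absolutely continuous on `(0,∞)` with derivative `f'`:
the fundamental theorem of calculus holds on every compact subinterval. -/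
def ACDerivOn (f f' : ℝ → ℝ) : Prop :=
  ∀ a b : ℝ, 0 < a → a ≤ b →
    IntegrableOn f' (Set.Icc a b) ∧ f b - f a = ∫ t in a..b, f' t

open Set Filter Topology

/-- Fundamental theorem of calculus for the square of an absolutely continuous function. -/
theorem ACDerivOn.sq_sub_sq {f f' : ℝ → ℝ} (h : ACDerivOn f f') {a b : ℝ} (ha : 0 < a)
    (hab : a ≤ b) : f b ^ 2 - f a ^ 2 = ∫ t in a..b, 2 * (f t * f' t) := by
  have hint : IntervalIntegrable f' volume a b :=
    (intervalIntegrable_iff_integrableOn_Icc_of_le hab).2 (h a b ha hab).1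
  have hF := hint.absolutelyContinuousOnInterval_intervalIntegral (c := a) (by simp)
  have hsq := AbsolutelyContinuousOnInterval.integral_deriv_mul_eq_sub hF hF
  have hb := (h a b ha hab).2
  have hcongr : ∫ t in a..b, 2 * (f t * f' t) =
      ∫ t in a..b, (2 * f a * f' t + (deriv (fun x ↦ ∫ v in a..x, f' v) t * (∫ v in a..t, f' v) +
        (∫ v in a..t, f' v) * deriv (fun x ↦ ∫ v in a..x, f' v) t)) := by
    apply intervalIntegral.integral_congr_ae
    filter_upwards [hint.ae_hasDerivAt_integral] with t ht htI
    have htI' := uIoc_subset_uIcc htI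
    rw [(ht htI' a (by simp)).deriv, ← (h a t ha (by rw [uIoc_of_le hab] at htI; exact htI.1.le)).2]
    ring
  rw [hcongr, intervalIntegral.integral_add (hint.const_mul _), hsq,
    intervalIntegral.integral_const_mul, ← hb]
  · simp only [intervalIntegral.integral_same]
    ring
  · exact (hF.intervalIntegrable_deriv.mul_continuousOn hF.continuousOn).add
      (hF.intervalIntegrable_deriv.continuousOn_mul hF.continuousOn)

theorem ACDerivOn.continuousOn {f f' : ℝ → ℝ} (h : ACDerivOn f f') :
    ContinuousOn f (Ioi 0) := by
  intro x hx
  have hx : 0 < x := hx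
  have hint : IntervalIntegrable f' volume (x / 2) (2 * x) :=
    (intervalIntegrable_iff_integrableOn_Icc_of_le (by linarith)).2
      (h (x / 2) (2 * x) (by linarith) (by linarith)).1
  have hF := (hint.absolutelyContinuousOnInterval_intervalIntegral
    (c := x / 2) (by simp)).continuousOn
  rw [uIcc_of_le (by linarith)] at hF
  have hnhds : Icc (x / 2) (2 * x) ∈ 𝓝 x := Icc_mem_nhds (by linarith) (by linarith)
  have hadd := (hF.continuousAt hnhds).const_add (f (x / 2))
  refine (hadd.congr ?_).continuousWithinAt
  filter_upwards [hnhds] with y hy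
  rw [← (h (x / 2) y (by linarith) hy.1).2]
  ring

/-- An absolutely continuous solution of `t f' = s f` is a multiple of `t ^ s`. -/
theorem ACDerivOn.mul_rpow_eq {f f' : ℝ → ℝ} (h : ACDerivOn f f') {s p q : ℝ} (hp : 0 < p)
    (hpq : p ≤ q) (hode : ∀ᵐ t ∂volume.restrict (Ioc p q), t * f' t = s * f t) :
    f q * q ^ (-s) = f p * p ^ (-s) := by
  have hcont : ContinuousOn (fun t ↦ s * f t / t) (Ioi 0) :=
    (continuousOn_const.mul h.continuousOn).div continuousOn_id fun t ht ↦ (ne_of_gt ht)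
  have hF : ∀ x ∈ Icc p q, f x = f p + ∫ t in p..x, s * f t / t := by
    intro x hx
    have hfx := (h p x hp hx.1).2
    have : ∫ t in p..x, f' t = ∫ t in p..x, s * f t / t := by
      rw [intervalIntegral.integral_of_le hx.1, intervalIntegral.integral_of_le hx.1]
      apply integral_congr_ae
      filter_upwards [ae_restrict_of_ae_restrict_of_subset (Ioc_subset_Ioc_right hx.2) hode,
        ae_restrict_mem measurableSet_Ioc] with t ht htm
      have : 0 < t := hp.trans htm.1
      rw [← ht]
      field_simp
    linarith
  have hder : ∀ x ∈ Icc p q, HasDerivAt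
      (fun x ↦ (f p + ∫ t in p..x, s * f t / t) * x ^ (-s)) 0 x := by
    intro x hx
    have hx0 : 0 < x := hp.trans_le hx.1
    have hI : HasDerivAt (fun x ↦ ∫ t in p..x, s * f t / t) (s * f x / x) x := by
      refine intervalIntegral.integral_hasDerivAt_right ?_ ?_ ?_
      · apply ContinuousOn.intervalIntegrable
        apply hcont.mono
        rw [uIcc_of_le hx.1]
        exact fun t ht ↦ hp.trans_le ht.1
      · exact hcont.stronglyMeasurableAtFilter isOpen_Ioi x hx0
      · exact hcont.continuousAt (Ioi_mem_nhds hx0)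
    have hprod := (hI.const_add (f p)).mul (Real.hasDerivAt_rpow_const (p := -s) (Or.inl hx0.ne'))
    refine hprod.congr_deriv ?_
    rw [← hF x hx, Real.rpow_sub_one hx0.ne']
    field_simp
    ring
  have hconst := constant_of_has_deriv_right_zero
    (fun x hx ↦ (hder x hx).continuousAt.continuousWithinAt)
    (fun x hx ↦ (hder x (Ico_subset_Icc_self hx)).hasDerivWithinAt) q ⟨hpq, le_rfl⟩
  rw [hF q ⟨hpq, le_rfl⟩, hconst]
  simp

/-- A nonnegative function with finite integral over `(0,∞)` is integrable on compact subintervals,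
with integral at most the total one. -/
theorem intervalIntegral_le_lintegral_Ioi {g : ℝ → ℝ} {a b : ℝ} (ha : 0 < a) (hab : a ≤ b)
    (hg : AEStronglyMeasurable g (volume.restrict (Ioc a b))) (hg0 : ∀ t, 0 < t → 0 ≤ g t)
    (hfin : ∫⁻ t in Ioi (0 : ℝ), ENNReal.ofReal (g t) ≠ ⊤) :
    IntervalIntegrable g volume a b ∧
      ∫ t in a..b, g t ≤ (∫⁻ t in Ioi (0 : ℝ), ENNReal.ofReal (g t)).toReal := by
  have hsub : Ioc a b ⊆ Ioi 0 := fun t ht ↦ ha.trans ht.1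
  have hle := lintegral_mono_set (μ := volume) (f := fun t ↦ ENNReal.ofReal (g t)) hsub
  have hnn : 0 ≤ᵐ[volume.restrict (Ioc a b)] g := by
    filter_upwards [ae_restrict_mem measurableSet_Ioc] with t ht using hg0 t (hsub ht)
  constructor
  · rw [intervalIntegrable_iff_integrableOn_Ioc_of_le hab]
    refine ⟨hg, ?_⟩
    rw [hasFiniteIntegral_iff_ofReal hnn]
    exact hle.trans_lt hfin.lt_top
  · rw [intervalIntegral.integral_of_le hab, integral_eq_lintegral_of_nonneg_ae hnn hg]
    exact ENNReal.toReal_mono hfin hle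

/-- Expansion of the weighted square `(t f' - s f)² / t`. -/
theorem ACDerivOn.integral_defect {f f' : ℝ → ℝ} (h : ACDerivOn f f') (s : ℝ) {a b : ℝ}
    (ha : 0 < a) (hab : a ≤ b)
    (hJ : IntervalIntegrable (fun t ↦ t * f' t ^ 2) volume a b) :
    IntervalIntegrable (fun t ↦ (t * f' t - s * f t) ^ 2 / t) volume a b ∧
      ∫ t in a..b, (t * f' t - s * f t) ^ 2 / t =
        (∫ t in a..b, t * f' t ^ 2) + s ^ 2 * (∫ t in a..b, f t ^ 2 / t) -
          s * (f b ^ 2 - f a ^ 2) := by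
  have hsub : uIcc a b ⊆ Ioi 0 := by
    rw [uIcc_of_le hab]
    exact fun t ht ↦ ha.trans_le ht.1
  have hfc := h.continuousOn.mono hsub
  have hf' : IntervalIntegrable f' volume a b :=
    (intervalIntegrable_iff_integrableOn_Icc_of_le hab).2 (h a b ha hab).1
  have hK : IntervalIntegrable (fun t ↦ f t ^ 2 / t) volume a b :=
    ((hfc.pow 2).div continuousOn_id fun t ht ↦ ne_of_gt (hsub ht)).intervalIntegrable
  have hX : IntervalIntegrable (fun t ↦ 2 * (f t * f' t)) volume a b :=
    (hf'.continuousOn_mul hfc).const_mul 2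
  have hEq : EqOn (fun t ↦ t * f' t ^ 2 + s ^ 2 * (f t ^ 2 / t) - s * (2 * (f t * f' t)))
      (fun t ↦ (t * f' t - s * f t) ^ 2 / t) (uIcc a b) := by
    intro t ht
    have : 0 < t := hsub ht
    simp only
    field_simp
    ring
  have hsum := (hJ.add (hK.const_mul (s ^ 2))).sub (hX.const_mul s)
  refine ⟨hsum.congr (hEq.mono uIoc_subset_uIcc), ?_⟩
  rw [← intervalIntegral.integral_congr hEq, intervalIntegral.integral_sub
    (hJ.add (hK.const_mul (s ^ 2))) (hX.const_mul s), intervalIntegral.integral_add hJ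
    (hK.const_mul (s ^ 2)), intervalIntegral.integral_const_mul,
    intervalIntegral.integral_const_mul, h.sq_sub_sq ha hab]

theorem ae_mul_eq_of_integral_defect_eq_zero {f f' : ℝ → ℝ} {s a b : ℝ}
    (ha : 0 < a) (hab : a ≤ b)
    (hint : IntervalIntegrable (fun t ↦ (t * f' t - s * f t) ^ 2 / t) volume a b)
    (hzero : ∫ t in a..b, (t * f' t - s * f t) ^ 2 / t = 0) :
    ∀ᵐ t ∂volume.restrict (Ioc a b), t * f' t = s * f t := by
  rw [intervalIntegral.integral_of_le hab, integral_eq_zero_iff_of_nonneg_ae _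
    ((intervalIntegrable_iff_integrableOn_Ioc_of_le hab).1 hint)] at hzero
  · filter_upwards [hzero, ae_restrict_mem measurableSet_Ioc] with t ht htm
    have h0 : 0 < t := ha.trans htm.1
    have := (div_eq_zero_iff.1 ht).resolve_right h0.ne'
    have := pow_eq_zero_iff (two_ne_zero) |>.1 this
    linarith
  · filter_upwards [ae_restrict_mem measurableSet_Ioc] with t htm
    have h0 : 0 < t := ha.trans htm.1
    simp only [Pi.zero_apply]
    positivity

/-- A continuous function on `(0,∞)` vanishing at both ends and positive somewhere has a maximum. -/
theorem exists_forall_le_of_tendsto_zero {f : ℝ → ℝ} (hf : ContinuousOn f (Ioi 0))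
    (h0 : Tendsto f (𝓝[>] 0) (𝓝 0)) (hinf : Tendsto f atTop (𝓝 0)) {r : ℝ} (hr : 0 < r)
    (hfr : 0 < f r) : ∃ m, 0 < m ∧ ∀ x, 0 < x → f x ≤ f m := by
  obtain ⟨δ, hδ, hδf⟩ := mem_nhdsGT_iff_exists_Ioo_subset.1 (h0.eventually (gt_mem_nhds hfr))
  obtain ⟨R, hR⟩ := eventually_atTop.1 (hinf.eventually (gt_mem_nhds hfr))
  have hδ : 0 < δ := hδ
  have hpos : 0 < min δ r := lt_min hδ hr
  have hrm : r ∈ Icc (min δ r) (max R r) := ⟨min_le_right _ _, le_max_right _ _⟩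
  obtain ⟨m, hm, hmax⟩ := isCompact_Icc.exists_isMaxOn ⟨r, hrm⟩
    (hf.mono fun t (ht : t ∈ Icc (min δ r) (max R r)) ↦ hpos.trans_le ht.1)
  refine ⟨m, hpos.trans_le hm.1, fun x hx ↦ ?_⟩
  by_cases hx1 : x < min δ r
  · exact (le_of_lt (hδf ⟨hx, hx1.trans_le (min_le_left _ _)⟩)).trans (hmax hrm)
  by_cases hx2 : max R r < x
  · exact (hR x ((le_max_left _ _).trans hx2.le)).le.trans (hmax hrm)
  exact hmax ⟨not_lt.1 hx1, not_lt.1 hx2⟩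

/-- Equality case: if `f : (0,∞) → [0,∞)` is absolutely continuous,
vanishing at `0⁺` and `∞`, not identically zero, and
`(∫_0^∞ r |f'|² dr)(∫_0^∞ |f|²/r dr) = ‖f‖_{L^∞}⁴`, then there are `A > 0`, `b > 0`, `c > 0`
with `f(r) = A (br)^c` for `r ≤ 1/b` and `f(r) = A (br)^{−c}` for `r ≥ 1/b`. -/
theorem stmt14 (f f' : ℝ → ℝ) (hAC : ACDerivOn f f')
    (hnonneg : ∀ r ∈ Set.Ioi (0 : ℝ), 0 ≤ f r)
    (hlim0 : Filter.Tendsto f (nhdsWithin 0 (Set.Ioi 0)) (nhds 0))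
    (hliminf : Filter.Tendsto f Filter.atTop (nhds 0))
    (hne : ∃ r ∈ Set.Ioi (0 : ℝ), f r ≠ 0)
    (heq : (∫⁻ r in Set.Ioi (0 : ℝ), ENNReal.ofReal (r * f' r ^ 2)) *
        (∫⁻ r in Set.Ioi (0 : ℝ), ENNReal.ofReal (f r ^ 2 / r)) =
      eLpNorm f ⊤ (volume.restrict (Set.Ioi 0)) ^ 4) :
    ∃ A : ℝ, 0 < A ∧ ∃ b : ℝ, 0 < b ∧ ∃ c : ℝ, 0 < c ∧
      (∀ r : ℝ, 0 < r → r ≤ 1 / b → f r = A * (b * r) ^ c) ∧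
      (∀ r : ℝ, 1 / b ≤ r → f r = A * (b * r) ^ (-c)) := by
  obtain ⟨r₀, hr₀, hfr₀⟩ := hne
  have hr₀ : 0 < r₀ := hr₀
  have hcont := hAC.continuousOn
  obtain ⟨m, hm, hmax⟩ := exists_forall_le_of_tendsto_zero hcont hlim0 hliminf hr₀
    (lt_of_le_of_ne (hnonneg r₀ hr₀) hfr₀.symm)
  have hM : 0 < f m := (lt_of_le_of_ne (hnonneg r₀ hr₀) hfr₀.symm).trans_le (hmax r₀ hr₀)
  set I := ∫⁻ r in Ioi (0 : ℝ), ENNReal.ofReal (r * f' r ^ 2)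
  set K := ∫⁻ r in Ioi (0 : ℝ), ENNReal.ofReal (f r ^ 2 / r)
  have hN_le : eLpNorm f ⊤ (volume.restrict (Ioi 0)) ≤ ENNReal.ofReal (f m) := by
    rw [eLpNorm_exponent_top]
    apply eLpNormEssSup_le_of_ae_bound
    filter_upwards [ae_restrict_mem measurableSet_Ioi] with t ht
    rw [Real.norm_of_nonneg (hnonneg t ht)]
    exact hmax t ht
  have hN_ne : eLpNorm f ⊤ (volume.restrict (Ioi 0)) ≠ 0 := by
    intro h
    rw [eLpNorm_eq_zero_iff (hcont.aestronglyMeasurable measurableSet_Ioi) (by simp)] at h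
    exact hfr₀ (Measure.eqOn_open_of_ae_eq h isOpen_Ioi hcont continuousOn_const hr₀)
  have hprod_ne : I * K ≠ 0 := by
    rw [heq]
    exact pow_ne_zero 4 hN_ne
  have hprod_le : I * K ≤ ENNReal.ofReal (f m ^ 4) := by
    rw [heq, ENNReal.ofReal_pow hM.le]
    gcongr
  have hprod_top : I * K ≠ ⊤ := ne_top_of_le_ne_top ENNReal.ofReal_ne_top hprod_le
  have hI0 : I ≠ 0 := left_ne_zero_of_mul hprod_ne
  have hK0 : K ≠ 0 := right_ne_zero_of_mul hprod_ne
  have hI_top : I ≠ ⊤ := fun h ↦ hprod_top (by rw [h, ENNReal.top_mul hK0])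
  have hK_top : K ≠ ⊤ := fun h ↦ hprod_top (by rw [h, ENNReal.mul_top hI0])
  have hIpos : 0 < I.toReal := ENNReal.toReal_pos hI0 hI_top
  have hKpos : 0 < K.toReal := ENNReal.toReal_pos hK0 hK_top
  have hprod_real : I.toReal * K.toReal ≤ f m ^ 4 := by
    rw [← ENNReal.toReal_mul]
    exact ENNReal.toReal_le_of_le_ofReal (by positivity) hprod_le
  obtain ⟨c, hc, hcK⟩ : ∃ c : ℝ, 0 < c ∧ c ^ 2 * K.toReal = I.toReal := by
    refine ⟨√(I.toReal / K.toReal), by positivity, ?_⟩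
    rw [Real.sq_sqrt (by positivity)]
    field_simp
  have hcM : c * K.toReal ≤ f m ^ 2 := by
    rw [← pow_le_pow_iff_left₀ (by positivity) (by positivity) two_ne_zero]
    calc (c * K.toReal) ^ 2 = c ^ 2 * K.toReal * K.toReal := by ring
      _ = I.toReal * K.toReal := by rw [hcK]
      _ ≤ f m ^ 4 := hprod_real
      _ = (f m ^ 2) ^ 2 := by ring
  have henergy : I.toReal + c ^ 2 * K.toReal ≤ 2 * c * f m ^ 2 := by nlinarith
  have hJint : ∀ a b, 0 < a → a ≤ b →
      IntervalIntegrable (fun t ↦ t * f' t ^ 2) volume a b ∧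
        ∫ t in a..b, t * f' t ^ 2 ≤ I.toReal := fun a b ha hab ↦
    intervalIntegral_le_lintegral_Ioi ha hab
      (aestronglyMeasurable_id.mul
        (((hAC a b ha hab).1.mono_set Ioc_subset_Icc_self).aestronglyMeasurable.pow 2))
      (fun t ht ↦ by positivity) hI_top
  have hKint : ∀ a b, 0 < a → a ≤ b →
      IntervalIntegrable (fun t ↦ f t ^ 2 / t) volume a b ∧
        ∫ t in a..b, f t ^ 2 / t ≤ K.toReal := fun a b ha hab ↦
    intervalIntegral_le_lintegral_Ioi ha hab
      ((((hcont.pow 2).div continuousOn_id fun t ht ↦ ne_of_gt ht).mono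
        fun t ht ↦ ha.trans ht.1).aestronglyMeasurable measurableSet_Ioc)
      (fun t ht ↦ by positivity) hK_top
  have hdefect : ∀ s a b : ℝ, 0 < a → a ≤ b → _ := fun s a b ha hab ↦
    hAC.integral_defect s ha hab (hJint a b ha hab).1
  have hnn : ∀ s a b : ℝ, 0 < a → a ≤ b → 0 ≤ ∫ t in a..b, (t * f' t - s * f t) ^ 2 / t := by
    intro s a b ha hab
    apply intervalIntegral.integral_nonneg hab
    intro t ht
    have : 0 < t := ha.trans_le ht.1
    positivity
  have hbound : ∀ p q, 0 < p → p ≤ m → m ≤ q →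
      (∫ t in p..m, (t * f' t - c * f t) ^ 2 / t) +
        (∫ t in m..q, (t * f' t - (-c) * f t) ^ 2 / t) ≤ c * (f p ^ 2 + f q ^ 2) := by
    intro p q hp hpm hmq
    rw [(hdefect c p m hp hpm).2, (hdefect (-c) m q hm hmq).2]
    have h1 := (hJint p q hp (hpm.trans hmq)).2
    have h2 := (hKint p q hp (hpm.trans hmq)).2
    rw [← intervalIntegral.integral_add_adjacent_intervals (hJint p m hp hpm).1
      (hJint m q hm hmq).1] at h1
    rw [← intervalIntegral.integral_add_adjacent_intervals (hKint p m hp hpm).1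
      (hKint m q hm hmq).1] at h2
    have h3 := mul_le_mul_of_nonneg_left h2 (sq_nonneg c)
    linarith
  have hsum_zero : ∀ p q, 0 < p → p ≤ m → m ≤ q →
      (∫ t in p..m, (t * f' t - c * f t) ^ 2 / t) +
        (∫ t in m..q, (t * f' t - (-c) * f t) ^ 2 / t) ≤ 0 := by
    intro p q hp hpm hmq
    have hlim : Tendsto (fun a ↦ c * (f a ^ 2 + f a⁻¹ ^ 2)) (𝓝[>] 0) (𝓝 0) := by
      simpa using ((hlim0.pow 2).add
        ((hliminf.comp tendsto_inv_nhdsGT_zero).pow 2)).const_mul c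
    refine ge_of_tendsto hlim ?_
    filter_upwards [Ioo_mem_nhdsGT hp, tendsto_inv_nhdsGT_zero.eventually_ge_atTop q]
      with a ha haq
    refine le_trans ?_ (hbound a a⁻¹ ha.1 (ha.2.le.trans hpm) (hmq.trans haq))
    rw [← intervalIntegral.integral_add_adjacent_intervals (hdefect c a p ha.1 ha.2.le).1
      (hdefect c p m hp hpm).1, ← intervalIntegral.integral_add_adjacent_intervals
      (hdefect (-c) m q hm hmq).1 (hdefect (-c) q a⁻¹ (hm.trans_le hmq) haq).1]
    have h1 := hnn c a p ha.1 ha.2.le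
    have h2 := hnn (-c) q a⁻¹ (hm.trans_le hmq) haq
    linarith
  refine ⟨f m, hM, 1 / m, by positivity, c, hc, fun r hr hrm ↦ ?_, fun r hrm ↦ ?_⟩
  · rw [one_div_one_div] at hrm
    have hz : ∫ t in r..m, (t * f' t - c * f t) ^ 2 / t = 0 := by
      have h1 := hsum_zero r m hr hrm le_rfl
      have h2 := hnn c r m hr hrm
      rw [intervalIntegral.integral_same] at h1
      linarith
    have hsol := hAC.mul_rpow_eq hr hrm (ae_mul_eq_of_integral_defect_eq_zero hr hrm
      (hdefect c r m hr hrm).1 hz)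
    rw [Real.mul_rpow (by positivity) hr.le, one_div, Real.inv_rpow hm.le,
      ← Real.rpow_neg hm.le, ← mul_assoc, hsol, mul_assoc, ← Real.rpow_add hr]
    simp
  · rw [one_div_one_div] at hrm
    have hr : 0 < r := hm.trans_le hrm
    have hz : ∫ t in m..r, (t * f' t - (-c) * f t) ^ 2 / t = 0 := by
      have h1 := hsum_zero m r hm le_rfl hrm
      have h2 := hnn (-c) m r hm hrm
      rw [intervalIntegral.integral_same] at h1
      linarith
    have hsol := hAC.mul_rpow_eq hm hrm (ae_mul_eq_of_integral_defect_eq_zero hm hrm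
      (hdefect (-c) m r hm hrm).1 hz)
    rw [Real.mul_rpow (by positivity) hr.le, one_div, Real.inv_rpow hm.le,
      ← Real.rpow_neg hm.le, ← mul_assoc, ← hsol, mul_assoc, ← Real.rpow_add hr]
    simp
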